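/- (L^r error bound for augmented resampling.) Under (A1), for any r ≥ 1 there exists a finite constant B_r depending only on r such that for any distribution of ξ_0 and any bounded measurable φ: E[ | ((1/N)Σ_i g(ξ_0^i))·((1/N)Σ_i φ(ξ_S^i)) − (1/N)Σ_i g(ξ_0^i)φ(ξ_0^i) |^r ]^{1/r} ≤ B_r · √(S/N) · ‖g‖ · osc(φ), where osc(φ) = sup_{x,y}|φ(x) − φ(y)|. -/

import Mathlib

open Matrix Kronecker

/-- The k×k all-ones matrix. -/
noncomputable def J (k : ℕ) : Matrix (Fin k) (Fin k) ℝ := Matrix.of fun _ _ => 1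

/-- The matrix `A_s := I_{2^{S-s}} ⊗ (1/2)J_2 ⊗ I_{2^{s-1}} ⊗ (1/M)J_M`
on the product index type. -/
noncomputable def Akron (S M s : ℕ) :
    Matrix (((Fin (2^(S-s)) × Fin 2) × Fin (2^(s-1))) × Fin M)
           (((Fin (2^(S-s)) × Fin 2) × Fin (2^(s-1))) × Fin M) ℝ :=
  (((1 : Matrix (Fin (2^(S-s))) (Fin (2^(S-s))) ℝ) ⊗ₖ ((1/2 : ℝ) • J 2)) ⊗ₖ
      (1 : Matrix (Fin (2^(s-1))) (Fin (2^(s-1))) ℝ)) ⊗ₖ ((1/(M:ℝ)) • J M)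

/-- Flattening equivalence for a triple Kronecker product (row-major order). -/
def bEquiv (a b c : ℕ) : (Fin a × Fin b) × Fin c ≃ Fin (a * b * c) :=
  (finProdFinEquiv.prodCongr (Equiv.refl (Fin c))).trans finProdFinEquiv

/-- Flattening equivalence for a fourfold Kronecker product (row-major order). -/
def aEquiv (a b c d : ℕ) : ((Fin a × Fin b) × Fin c) × Fin d ≃ Fin (a * b * c * d) :=
  ((bEquiv a b c).prodCongr (Equiv.refl (Fin d))).trans finProdFinEquiv

lemma size_eq (S s M : ℕ) (h1 : 1 ≤ s) (h2 : s ≤ S) :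
    2^(S-s) * 2 * 2^(s-1) * M = 2^S * M := by
  have hS : S - s + (s - 1) + 1 = S := by omega
  calc 2^(S-s) * 2 * 2^(s-1) * M = (2^(S-s) * 2^(s-1) * 2^1) * M := by ring
    _ = 2^(S - s + (s-1) + 1) * M := by rw [pow_add, pow_add]
    _ = 2^S * M := by rw [hS]

/-- The matrix `A_s` viewed as an `N × N` matrix, `N = 2^S·M`, with the rows and
columns ordered consistently with the Kronecker (row-major) structure. -/
noncomputable def Amat (S M s : ℕ) : Matrix (Fin (2^S * M)) (Fin (2^S * M)) ℝ :=
  if h : 1 ≤ s ∧ s ≤ S then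
    Matrix.reindex
      ((aEquiv (2^(S-s)) 2 (2^(s-1)) M).trans (finCongr (size_eq S s M h.1 h.2)))
      ((aEquiv (2^(S-s)) 2 (2^(s-1)) M).trans (finCongr (size_eq S s M h.1 h.2)))
      (Akron S M s)
  else 0



open MeasureTheory

/-- Generating pi-system of the sigma-algebra of `G` and all particles except `i`. -/
def rectSets {Ω X ι : Type*} (G : MeasurableSpace Ω) (mX : MeasurableSpace X) (ξ : ι → Ω → X) (i : ι) :
    Set (Set Ω) :=
  {s | ∃ B, MeasurableSet[G] B ∧ ∃ A : ι → Set X, (∀ k, MeasurableSet[mX] (A k)) ∧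
    s = {ω | ω ∈ B ∧ ∀ k, k ≠ i → ξ k ω ∈ A k}}

/-- The sigma-algebra of `G` and all particles except `i`. -/
@[reducible] def restAlg {Ω X ι : Type*} (G : MeasurableSpace Ω) (mX : MeasurableSpace X) (ξ : ι → Ω → X) (i : ι) :
    MeasurableSpace Ω := MeasurableSpace.generateFrom (rectSets G mX ξ i)

lemma rect_pi {Ω X ι : Type*} (G : MeasurableSpace Ω) (mX : MeasurableSpace X) (ξ : ι → Ω → X)
    (i : ι) : IsPiSystem (rectSets G mX ξ i) := by
  rintro _ ⟨B, hB, A, hA, rfl⟩ _ ⟨B', hB', A', hA', rfl⟩ _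
  refine ⟨B ∩ B', hB.inter hB', fun k => A k ∩ A' k, fun k => (hA k).inter (hA' k), ?_⟩
  ext ω
  simp only [Set.mem_inter_iff, Set.mem_ofPred_eq]
  grind

lemma le_restAlg {Ω X ι : Type*} (G : MeasurableSpace Ω) (mX : MeasurableSpace X) (ξ : ι → Ω → X)
    (i : ι) : G ≤ restAlg G mX ξ i := by
  intro B hB
  apply MeasurableSpace.measurableSet_generateFrom
  exact ⟨B, hB, fun _ => Set.univ, fun _ => MeasurableSet.univ, by ext; simp⟩

lemma restAlg_le {Ω X ι : Type*} [Finite ι] (G : MeasurableSpace Ω) (m0 : MeasurableSpace Ω)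
    (hG : G ≤ m0) (mX : MeasurableSpace X) (ξ : ι → Ω → X) (hξ : ∀ k, Measurable (ξ k))
    (i : ι) : restAlg G mX ξ i ≤ m0 := by
  apply MeasurableSpace.generateFrom_le
  rintro _ ⟨B, hB, A, hA, rfl⟩
  refine (hG _ hB).inter ?_
  have : {ω | ∀ k, k ≠ i → ξ k ω ∈ A k} = ⋂ k, ⋂ (_ : k ≠ i), ξ k ⁻¹' A k := by ext; simp
  change MeasurableSet {ω | ∀ k, k ≠ i → ξ k ω ∈ A k}
  rw [this]
  exact MeasurableSet.iInter fun k => MeasurableSet.iInter fun _ => hξ k (hA k)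

lemma meas_restAlg {Ω X ι : Type*} (G : MeasurableSpace Ω) (mX : MeasurableSpace X)
    (ξ : ι → Ω → X) (i k : ι) (hk : k ≠ i) : Measurable[restAlg G mX ξ i] (ξ k) := by
  classical
  intro A hA
  apply MeasurableSpace.measurableSet_generateFrom
  refine ⟨Set.univ, @MeasurableSet.univ _ G, fun l => if l = k then A else Set.univ, ?_, ?_⟩
  · intro l; dsimp only; split_ifs
    · exact hA
    · exact MeasurableSet.univ
  · ext ω
    simp only [Set.mem_preimage, Set.mem_univ, true_and, Set.mem_ofPred_eq]
    constructor
    · intro h l hl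
      split_ifs with h'
      · subst h'; exact h
      · trivial
    · intro h; simpa using h k hk

lemma integrable_bdd {Ω : Type*} {m0 : MeasurableSpace Ω} {μ : Measure Ω} [IsProbabilityMeasure μ]
    {f : Ω → ℝ} (hf : Measurable f) (C : ℝ) (hC : ∀ ω, |f ω| ≤ C) : Integrable f μ :=
  Integrable.of_bound hf.aestronglyMeasurable C (Filter.Eventually.of_forall hC)

/-- product rule -/
lemma cond_prod {Ω X ι : Type*} [Fintype ι] {G m0 : MeasurableSpace Ω} (hG : G ≤ m0)
    {mX : MeasurableSpace X} {μ : Measure Ω} [IsProbabilityMeasure μ]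
    (ξ : ι → Ω → X) (hξ : ∀ k, Measurable (ξ k))
    (H2 : ∀ ψ : ι → X → ℝ, (∀ i, Measurable (ψ i)) → (∀ i, ∃ C, ∀ x, |ψ i x| ≤ C) →
        μ[(fun ω => ∏ i, ψ i (ξ i ω)) | G] =ᵐ[μ]
          fun ω => ∏ i, (μ[(fun ω' => ψ i (ξ i ω')) | G]) ω)
    (i : ι) (φ : X → ℝ) (hφ : Measurable φ) (hφb : ∃ C, ∀ x, |φ x| ≤ C)
    (m : Ω → ℝ) (hm : Measurable[G] m) (Cm : ℝ) (hmb : ∀ ω, |m ω| ≤ Cm)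
    (hE : μ[(fun ω => φ (ξ i ω)) | G] =ᵐ[μ] m)
    (s : Set Ω) (hs : s ∈ rectSets G mX ξ i) :
    ∫ ω in s, (φ (ξ i ω) - m ω) ∂μ = 0 := by
  classical
  obtain ⟨B, hB, A, hA, rfl⟩ := hs
  obtain ⟨C, hC⟩ := hφb
  let a : ι → X → ℝ := fun k => (A k).indicator (fun _ => 1)
  have ha : ∀ k, Measurable (a k) := fun k => measurable_const.indicator (hA k)
  have hab : ∀ k x, |a k x| ≤ 1 := by
    intro k x
    by_cases h : x ∈ A k <;> simp [a, h]
  let R : Ω → ℝ := fun ω => ∏ k ∈ Finset.univ.erase i, a k (ξ k ω)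
  have hR : Measurable R := Finset.measurable_prod _ fun k _ => (ha k).comp (hξ k)
  have hRb : ∀ ω, |R ω| ≤ 1 := by
    intro ω
    simp only [R, Finset.abs_prod]
    exact Finset.prod_le_one (fun _ _ => abs_nonneg _) (fun k _ => hab k _)
  have key : ∀ f : X → ℝ, Measurable f → (∃ C, ∀ x, |f x| ≤ C) →
      μ[(fun ω => f (ξ i ω) * R ω) | G] =ᵐ[μ] fun ω => (μ[(fun ω => f (ξ i ω)) | G]) ω *
        ∏ k ∈ Finset.univ.erase i, (μ[(fun ω' => a k (ξ k ω')) | G]) ω := by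
    intro f hf hfb
    have h := H2 (Function.update a i f) (by
      intro k
      by_cases hk : k = i
      · subst hk; simpa using hf
      · simpa [hk] using ha k) (by
      intro k
      by_cases hk : k = i
      · subst hk; simpa using hfb
      · simpa [hk] using ⟨1, hab k⟩)
    have e1 : (fun ω => ∏ k, Function.update a i f k (ξ k ω)) = fun ω => f (ξ i ω) * R ω := by
      funext ω
      rw [← Finset.mul_prod_erase _ _ (Finset.mem_univ i)]
      simp only [Function.update_self, R]
      congr 1
      refine Finset.prod_congr rfl fun k hk => ?_
      rw [Function.update_of_ne (Finset.ne_of_mem_erase hk)]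
    rw [e1] at h
    refine h.trans (Filter.Eventually.of_forall fun ω => ?_)
    dsimp only
    rw [← Finset.mul_prod_erase _ _ (Finset.mem_univ i)]
    simp only [Function.update_self]
    congr 1
    refine Finset.prod_congr rfl fun k hk => ?_
    rw [Function.update_of_ne (Finset.ne_of_mem_erase hk)]
  have k1 := key φ hφ ⟨C, hC⟩
  have k2 := key (fun _ => 1) measurable_const ⟨1, by simp⟩
  simp only [one_mul, condExp_const hG] at k2
  have hφR : Integrable (fun ω => φ (ξ i ω) * R ω) μ := by
    refine integrable_bdd ((hφ.comp (hξ i)).mul hR) (C * 1) fun ω => ?_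
    rw [abs_mul]
    exact mul_le_mul (hC _) (hRb _) (abs_nonneg _) ((abs_nonneg _).trans (hC (ξ i ω)))
  have hmR : Integrable (fun ω => m ω * R ω) μ := by
    refine integrable_bdd ((hm.mono hG le_rfl).mul hR) (Cm * 1) fun ω => ?_
    rw [abs_mul]
    exact mul_le_mul (hmb _) (hRb _) (abs_nonneg _) ((abs_nonneg _).trans (hmb ω))
  have hRi : Integrable R μ := integrable_bdd hR 1 hRb
  have k3 : μ[(fun ω => m ω * R ω) | G] =ᵐ[μ] fun ω => m ω * (μ[R | G]) ω :=
    condExp_mul_of_stronglyMeasurable_left hm.stronglyMeasurable hmR hRi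
  have k4 : μ[(fun ω => φ (ξ i ω) * R ω) | G] =ᵐ[μ] μ[(fun ω => m ω * R ω) | G] := by
    filter_upwards [k1, k2, k3, hE] with ω h1 h2 h3 h4
    rw [h1, h3, h4, h2]
  have k5 : ∫ ω in B, φ (ξ i ω) * R ω ∂μ = ∫ ω in B, m ω * R ω ∂μ := by
    rw [← setIntegral_condExp hG hφR hB, ← setIntegral_condExp hG hmR hB]
    exact integral_congr_ae (ae_restrict_of_ae k4)
  have hRind : ∀ ω, R ω = {ω | ∀ k, k ≠ i → ξ k ω ∈ A k}.indicator (fun _ => (1:ℝ)) ω := by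
    intro ω
    by_cases h : ∀ k, k ≠ i → ξ k ω ∈ A k
    · rw [Set.indicator_of_mem (by exact h)]
      refine Finset.prod_eq_one fun k hk => ?_
      simp [a, h k (Finset.ne_of_mem_erase hk)]
    · rw [Set.indicator_of_notMem (by exact h)]
      push Not at h
      obtain ⟨k, hk, hk'⟩ := h
      exact Finset.prod_eq_zero (Finset.mem_erase.2 ⟨hk, Finset.mem_univ _⟩) (by simp [a, hk'])
  have hMs : MeasurableSet {ω | ∀ k, k ≠ i → ξ k ω ∈ A k} := by
    have : {ω | ∀ k, k ≠ i → ξ k ω ∈ A k} = ⋂ k, ⋂ (_ : k ≠ i), ξ k ⁻¹' A k := by ext; simp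
    rw [this]
    exact MeasurableSet.iInter fun k => MeasurableSet.iInter fun _ => hξ k (hA k)
  have e : {ω | ω ∈ B ∧ ∀ k, k ≠ i → ξ k ω ∈ A k} = B ∩ {ω | ∀ k, k ≠ i → ξ k ω ∈ A k} := rfl
  rw [e, ← setIntegral_indicator hMs]
  have : ∀ ω, {ω | ∀ k, k ≠ i → ξ k ω ∈ A k}.indicator (fun ω => φ (ξ i ω) - m ω) ω
      = φ (ξ i ω) * R ω - m ω * R ω := by
    intro ω
    rw [hRind]
    by_cases h : ω ∈ {ω | ∀ k, k ≠ i → ξ k ω ∈ A k} <;> simp only [h, Set.indicator_of_mem, Set.indicator_of_notMem, not_false_eq_true] <;> ring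
  simp only [this]
  rw [integral_sub hφR.integrableOn hmR.integrableOn, k5, sub_self]

lemma ortho {Ω X ι : Type*} [Fintype ι] {G m0 : MeasurableSpace Ω} (hG : G ≤ m0)
    {mX : MeasurableSpace X} {μ : Measure Ω} [IsProbabilityMeasure μ]
    (ξ : ι → Ω → X) (hξ : ∀ k, Measurable (ξ k))
    (H2 : ∀ ψ : ι → X → ℝ, (∀ i, Measurable (ψ i)) → (∀ i, ∃ C, ∀ x, |ψ i x| ≤ C) →
        μ[(fun ω => ∏ i, ψ i (ξ i ω)) | G] =ᵐ[μ]
          fun ω => ∏ i, (μ[(fun ω' => ψ i (ξ i ω')) | G]) ω)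
    (i : ι) (φ : X → ℝ) (hφ : Measurable φ) (hφb : ∃ C, ∀ x, |φ x| ≤ C)
    (m : Ω → ℝ) (hm : Measurable[G] m) (Cm : ℝ) (hmb : ∀ ω, |m ω| ≤ Cm)
    (hE : μ[(fun ω => φ (ξ i ω)) | G] =ᵐ[μ] m)
    (W : Ω → ℝ) (hW : Measurable[restAlg G mX ξ i] W) (CW : ℝ) (hWb : ∀ ω, |W ω| ≤ CW) :
    ∫ ω, W ω * (φ (ξ i ω) - m ω) ∂μ = 0 := by
  have hF := restAlg_le G m0 hG mX ξ hξ i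
  obtain ⟨C, hC⟩ := hφb
  have hfm : Measurable (fun ω => φ (ξ i ω) - m ω) := (hφ.comp (hξ i)).sub (hm.mono hG le_rfl)
  have hfb : ∀ ω, |φ (ξ i ω) - m ω| ≤ C + Cm := fun ω =>
    (abs_sub _ _).trans (add_le_add (hC _) (hmb _))
  have hf : Integrable (fun ω => φ (ξ i ω) - m ω) μ := integrable_bdd hfm _ hfb
  have hrect := cond_prod hG ξ hξ H2 i φ hφ ⟨C, hC⟩ m hm Cm hmb hE
  have huniv : ∫ ω, (φ (ξ i ω) - m ω) ∂μ = 0 := by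
    rw [← setIntegral_univ]
    apply hrect
    exact ⟨Set.univ, @MeasurableSet.univ _ G, fun _ => Set.univ, fun _ => MeasurableSet.univ,
      by ext; simp⟩
  have hall : ∀ s, MeasurableSet[restAlg G mX ξ i] s → ∫ ω in s, (φ (ξ i ω) - m ω) ∂μ = 0 := by
    intro s hs
    induction s, hs using MeasurableSpace.induction_on_inter (m := restAlg G mX ξ i) rfl
      (rect_pi G mX ξ i) with
    | empty => simp
    | basic t ht => exact hrect t ht
    | compl t ht ih =>
      have := integral_add_compl (hF t ht) hf
      rw [ih, huniv, zero_add] at this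
      exact this
    | iUnion f hd hf' ih =>
      rw [integral_iUnion (fun n => hF _ (hf' n)) hd hf.integrableOn]
      simp [ih]
  have hz : (0 : Ω → ℝ) =ᵐ[μ] μ[(fun ω => φ (ξ i ω) - m ω) | restAlg G mX ξ i] := by
    refine ae_eq_condExp_of_forall_setIntegral_eq hF hf (fun _ _ _ => integrableOn_zero) ?_ ?_
    · intro s hs _
      rw [hall s hs]; simp
    · exact stronglyMeasurable_zero.aestronglyMeasurable
  have hWf : Integrable (fun ω => W ω * (φ (ξ i ω) - m ω)) μ := by
    refine integrable_bdd ((hW.mono hF le_rfl).mul hfm) (CW * (C + Cm)) fun ω => ?_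
    rw [abs_mul]
    exact mul_le_mul (hWb _) (hfb _) (abs_nonneg _) ((abs_nonneg _).trans (hWb ω))
  have k3 : μ[(fun ω => W ω * (φ (ξ i ω) - m ω)) | restAlg G mX ξ i] =ᵐ[μ]
      fun ω => W ω * (μ[(fun ω => φ (ξ i ω) - m ω) | restAlg G mX ξ i]) ω :=
    condExp_mul_of_stronglyMeasurable_left hW.stronglyMeasurable hWf hf
  rw [← integral_condExp hF, integral_congr_ae k3]
  rw [integral_congr_ae (g := fun _ => (0:ℝ))]
  · simp
  · filter_upwards [hz] with ω h
    rw [← h]; simp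

lemma exp_chord (t K y : ℝ) (hy : |y| ≤ K) :
    Real.exp (t * y) ≤ Real.cosh (t * K) + Real.sinh (t * K) / K * y := by
  rcases eq_or_lt_of_le ((abs_nonneg y).trans hy) with h | h
  · subst h
    have : y = 0 := by simpa using hy
    subst this; simp
  · have hcv := convexOn_exp.2
    have hc := @hcv (t * K) (Set.mem_univ (t * K)) (-(t * K)) (Set.mem_univ _)
      ((1 + y / K) / 2) ((1 - y / K) / 2) ?_ ?_ (by ring)
    · simp only [smul_eq_mul] at hc
      have e : (1 + y / K) / 2 * (t * K) + (1 - y / K) / 2 * -(t * K) = t * y := by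
        field_simp; ring
      rw [e] at hc
      refine hc.trans (le_of_eq ?_)
      rw [Real.cosh_eq, Real.sinh_eq]
      ring
    · have : -1 ≤ y / K := by rw [le_div_iff₀ h]; linarith [neg_abs_le y]
      linarith
    · have : y / K ≤ 1 := by rw [div_le_iff₀ h]; linarith [le_abs_self y]
      linarith

lemma step_mgf {Ω X ι : Type*} [Fintype ι] {G m0 : MeasurableSpace Ω} (hG : G ≤ m0)
    {mX : MeasurableSpace X} {μ : Measure Ω} [IsProbabilityMeasure μ]
    (ξ : ι → Ω → X) (hξ : ∀ k, Measurable (ξ k))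
    (H2 : ∀ ψ : ι → X → ℝ, (∀ i, Measurable (ψ i)) → (∀ i, ∃ C, ∀ x, |ψ i x| ≤ C) →
        μ[(fun ω => ∏ i, ψ i (ξ i ω)) | G] =ᵐ[μ]
          fun ω => ∏ i, (μ[(fun ω' => ψ i (ξ i ω')) | G]) ω)
    (φ : X → ℝ) (hφ : Measurable φ) (hφb : ∃ C, ∀ x, |φ x| ≤ C)
    (V Q : ι → Ω → ℝ) (hV : ∀ i, Measurable[G] (V i)) (hQ : ∀ i, Measurable[G] (Q i))
    (hVpos : ∀ i ω, 0 < V i ω) (CV : ℝ) (hVb : ∀ i ω, V i ω ≤ CV)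
    (Cm : ℝ) (hmb : ∀ i ω, |(V i ω)⁻¹ * Q i ω| ≤ Cm)
    (hE : ∀ i, μ[(fun ω => φ (ξ i ω)) | G] =ᵐ[μ] fun ω => (V i ω)⁻¹ * Q i ω)
    (K : ℝ) (hK : ∀ i ω, |V i ω * φ (ξ i ω) - Q i ω| ≤ K)
    (t : ℝ) (Z : Ω → ℝ) (hZ : Measurable[G] Z) (hZ0 : ∀ ω, 0 ≤ Z ω) (CZ : ℝ) (hZb : ∀ ω, Z ω ≤ CZ)
    (T : Finset ι) :
    ∫ ω, Z ω * Real.exp (t * ∑ i ∈ T, (V i ω * φ (ξ i ω) - Q i ω)) ∂μ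
      ≤ Real.exp (T.card * ((t * K) ^ 2 / 2)) * ∫ ω, Z ω ∂μ := by
  classical
  induction T using Finset.induction_on with
  | empty => simp
  | insert i T hi ih =>
    have hF := restAlg_le G m0 hG mX ξ hξ i
    have hGF := le_restAlg G mX ξ i
    set W : Ω → ℝ := fun ω => Z ω * Real.exp (t * ∑ i ∈ T, (V i ω * φ (ξ i ω) - Q i ω)) with hWdef
    have hW : Measurable[restAlg G mX ξ i] W := by
      refine (hZ.mono hGF le_rfl).mul (Real.measurable_exp.comp (Measurable.const_mul ?_ t))
      refine Finset.measurable_sum _ fun k hk => ?_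
      have hki : k ≠ i := fun h => hi (h ▸ hk)
      exact (((hV k).mono hGF le_rfl).mul (hφ.comp (meas_restAlg G mX ξ i k hki))).sub
        ((hQ k).mono hGF le_rfl)
    have hW0 : ∀ ω, 0 ≤ W ω := fun ω => mul_nonneg (hZ0 ω) (Real.exp_pos _).le
    set CW := CZ * Real.exp (|t| * (T.card * K))
    have hWb : ∀ ω, |W ω| ≤ CW := by
      intro ω
      rw [abs_of_nonneg (hW0 ω)]
      refine mul_le_mul (hZb ω) (Real.exp_le_exp.2 ?_) (Real.exp_pos _).le ((hZ0 ω).trans (hZb ω))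
      refine (le_abs_self _).trans ?_
      rw [abs_mul]
      refine mul_le_mul_of_nonneg_left ?_ (abs_nonneg _)
      refine (Finset.abs_sum_le_sum_abs _ _).trans ?_
      refine (Finset.sum_le_card_nsmul _ _ K fun k _ => hK k ω).trans ?_
      simp
    have hWm := hW.mono hF le_rfl
    have hY : Measurable (fun ω => V i ω * φ (ξ i ω) - Q i ω) :=
      (((hV i).mono hG le_rfl).mul (hφ.comp (hξ i))).sub ((hQ i).mono hG le_rfl)
    have hort : ∫ ω, W ω * (V i ω * φ (ξ i ω) - Q i ω) ∂μ = 0 := by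
      have h := ortho hG ξ hξ H2 i φ hφ hφb (fun ω => (V i ω)⁻¹ * Q i ω)
        ((hV i).inv.mul (hQ i)) Cm (hmb i) (hE i) (fun ω => W ω * V i ω)
        (hW.mul ((hV i).mono hGF le_rfl)) (CW * CV) ?_
      · rw [← h]
        congr 1
        funext ω
        have := (hVpos i ω).ne'
        field_simp
      · intro ω
        rw [abs_mul, abs_of_pos (hVpos i ω)]
        exact mul_le_mul (hWb ω) (hVb i ω) (hVpos i ω).le ((abs_nonneg _).trans (hWb ω))
    have hWi : Integrable W μ := integrable_bdd hWm _ hWb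
    have hWYi : Integrable (fun ω => W ω * (V i ω * φ (ξ i ω) - Q i ω)) μ := by
      refine integrable_bdd (hWm.mul hY) (CW * K) fun ω => ?_
      rw [abs_mul]
      exact mul_le_mul (hWb ω) (hK i ω) (abs_nonneg _) ((abs_nonneg _).trans (hWb ω))
    have e1 : ∀ ω, Z ω * Real.exp (t * ∑ k ∈ insert i T, (V k ω * φ (ξ k ω) - Q k ω))
        = W ω * Real.exp (t * (V i ω * φ (ξ i ω) - Q i ω)) := by
      intro ω
      rw [Finset.sum_insert hi, mul_add, Real.exp_add, hWdef]
      ring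
    simp only [e1]
    have hWE : Integrable (fun ω => W ω * Real.exp (t * (V i ω * φ (ξ i ω) - Q i ω))) μ := by
      refine integrable_bdd (hWm.mul (Real.measurable_exp.comp (hY.const_mul t)))
        (CW * Real.exp (|t| * K)) fun ω => ?_
      rw [abs_mul, Real.abs_exp]
      refine mul_le_mul (hWb ω) (Real.exp_le_exp.2 ?_) (Real.exp_pos _).le
        ((abs_nonneg _).trans (hWb ω))
      refine (le_abs_self _).trans ?_
      rw [abs_mul]
      exact mul_le_mul_of_nonneg_left (hK i ω) (abs_nonneg _)
    calc ∫ ω, W ω * Real.exp (t * (V i ω * φ (ξ i ω) - Q i ω)) ∂μ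
        ≤ ∫ ω, (Real.cosh (t * K) * W ω
            + Real.sinh (t * K) / K * (W ω * (V i ω * φ (ξ i ω) - Q i ω))) ∂μ := by
          refine integral_mono hWE ((hWi.const_mul _).add (hWYi.const_mul _)) fun ω => ?_
          refine (mul_le_mul_of_nonneg_left (exp_chord t K _ (hK i ω)) (hW0 ω)).trans
            (le_of_eq ?_)
          ring
      _ = Real.cosh (t * K) * ∫ ω, W ω ∂μ := by
          rw [integral_add (hWi.const_mul _) (hWYi.const_mul _), integral_const_mul,
            integral_const_mul, hort]
          ring
      _ ≤ Real.exp ((t * K) ^ 2 / 2) * (Real.exp (T.card * ((t * K) ^ 2 / 2)) * ∫ ω, Z ω ∂μ) :=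
          mul_le_mul (Real.cosh_le_exp_half_sq _) ih (integral_nonneg hW0) (Real.exp_pos _).le
      _ = _ := by
          rw [← mul_assoc, ← Real.exp_add, Finset.card_insert_of_notMem hi]
          congr 2
          push_cast; ring

/-- The index equivalence used in `Amat`. -/
def eA (S M s : ℕ) (h1 : 1 ≤ s) (h2 : s ≤ S) :
    ((Fin (2^(S-s)) × Fin 2) × Fin (2^(s-1))) × Fin M ≃ Fin (2^S * M) :=
  (aEquiv (2^(S-s)) 2 (2^(s-1)) M).trans (finCongr (size_eq S s M h1 h2))

lemma eA_val (S M s : ℕ) (h1 : 1 ≤ s) (h2 : s ≤ S) (p) :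
    (eA S M s h1 h2 p : ℕ) = p.2 + M * (p.1.2 + 2^(s-1) * (p.1.1.2 + 2 * p.1.1.1)) := by
  simp [eA, aEquiv, bEquiv, finProdFinEquiv]

lemma Amat_apply (S M s : ℕ) (h1 : 1 ≤ s) (h2 : s ≤ S) (p q) :
    Amat S M s (eA S M s h1 h2 p) (eA S M s h1 h2 q) =
      (if p.1.1.1 = q.1.1.1 then 1 else 0) * (1/2) * (if p.1.2 = q.1.2 then 1 else 0) * (1/(M:ℝ)) := by
  have h : 1 ≤ s ∧ s ≤ S := ⟨h1, h2⟩
  obtain ⟨⟨⟨a, b⟩, c⟩, d⟩ := p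
  obtain ⟨⟨⟨a', b'⟩, c'⟩, d'⟩ := q
  unfold Amat
  rw [dif_pos h]
  simp only [eA, Matrix.reindex_apply, Matrix.submatrix_apply, Equiv.symm_apply_apply, Akron,
    Matrix.kroneckerMap_apply, Matrix.one_apply, _root_.J, Matrix.smul_apply, Matrix.of_apply, smul_eq_mul,
    mul_one]

lemma Amat_sum (S M s : ℕ) (h1 : 1 ≤ s) (h2 : s ≤ S) (p) (f : Fin (2^S * M) → ℝ) :
    ∑ j, Amat S M s (eA S M s h1 h2 p) j * f j =
      (1/2) * (1/(M:ℝ)) * ∑ b, ∑ d, f (eA S M s h1 h2 (((p.1.1.1, b), p.1.2), d)) := by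
  rw [← (eA S M s h1 h2).sum_comp]
  simp only [Amat_apply, Fintype.sum_prod_type]
  simp only [mul_assoc, ite_mul, zero_mul, one_mul, Finset.sum_ite_irrel, Finset.sum_const_zero, 
    mul_ite, mul_zero, Finset.sum_ite_eq, Finset.mem_univ, if_true, Finset.mul_sum]

lemma Amat_symm (S M s : ℕ) (h1 : 1 ≤ s) (h2 : s ≤ S) (i j) : Amat S M s i j = Amat S M s j i := by
  obtain ⟨p, rfl⟩ := (eA S M s h1 h2).surjective i
  obtain ⟨q, rfl⟩ := (eA S M s h1 h2).surjective j
  rw [Amat_apply, Amat_apply]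
  simp only [eq_comm]

lemma Amat_nonneg (S M s : ℕ) (h1 : 1 ≤ s) (h2 : s ≤ S) (i j) : 0 ≤ Amat S M s i j := by
  obtain ⟨p, rfl⟩ := (eA S M s h1 h2).surjective i
  obtain ⟨q, rfl⟩ := (eA S M s h1 h2).surjective j
  rw [Amat_apply]
  positivity

lemma Amat_row (S M s : ℕ) (hM : 0 < M) (h1 : 1 ≤ s) (h2 : s ≤ S) (i) :
    ∑ j, Amat S M s i j = 1 := by
  obtain ⟨p, rfl⟩ := (eA S M s h1 h2).surjective i
  have := Amat_sum S M s h1 h2 p (fun _ => 1)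
  simp only [mul_one] at this
  rw [this]
  have : (M:ℝ) ≠ 0 := by positivity
  simp
  field_simp

lemma Amat_col (S M s : ℕ) (hM : 0 < M) (h1 : 1 ≤ s) (h2 : s ≤ S) (f : Fin (2^S * M) → ℝ) :
    ∑ i, ∑ j, Amat S M s i j * f j = ∑ j, f j := by
  rw [Finset.sum_comm]
  refine Finset.sum_congr rfl fun j _ => ?_
  rw [← Finset.sum_mul]
  simp only [Amat_symm S M s h1 h2 _ j]
  rw [Amat_row S M s hM h1 h2, one_mul]

lemma V_block (S M : ℕ) (hM : 0 < M) (v : ℕ → Fin (2^S * M) → ℝ)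
    (hv : ∀ s, 1 ≤ s → s ≤ S → ∀ i, v s i = ∑ j, Amat S M s i j * v (s - 1) j) :
    ∀ s, 1 ≤ s → s ≤ S → ∀ i j : Fin (2^S * M), (i : ℕ) / (2^s * M) = (j : ℕ) / (2^s * M) →
      v s i = v s j := by
  have hdiv : ∀ s (h1 : 1 ≤ s) (h2 : s ≤ S) p, (eA S M s h1 h2 p : ℕ) / (2^(s-1) * M)
      = p.1.1.2 + 2 * p.1.1.1 := by
    intro s h1 h2 p
    rw [eA_val, mul_comm (2^(s-1)) M, ← Nat.div_div_eq_div_mul, Nat.add_mul_div_left _ _ hM,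
      Nat.div_eq_of_lt p.2.2, zero_add, Nat.add_mul_div_left _ _ (by positivity),
      Nat.div_eq_of_lt p.1.2.2, zero_add]
  intro s h1
  induction s, h1 using Nat.le_induction with
  | base =>
    intro h2 i j hij
    obtain ⟨p, rfl⟩ := (eA S M 1 le_rfl h2).surjective i
    obtain ⟨q, rfl⟩ := (eA S M 1 le_rfl h2).surjective j
    have e : ∀ n, n / (2^1 * M) = n / (2^(1-1) * M) / 2 := by
      intro n; rw [Nat.div_div_eq_div_mul]; congr 1; simp; ring
    rw [e, e, hdiv, hdiv] at hij
    have hx : p.1.1.1 = q.1.1.1 := by ext; omega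
    have hc : p.1.2 = q.1.2 := by
      have := p.1.2.2; have := q.1.2.2; ext; simp only [Nat.sub_self, pow_zero] at *; omega
    rw [hv 1 le_rfl h2, hv 1 le_rfl h2, Amat_sum, Amat_sum, hx, hc]
  | succ s h1 ih =>
    intro h2 i j hij
    have h1' : 1 ≤ s + 1 := by omega
    obtain ⟨p, rfl⟩ := (eA S M (s+1) h1' h2).surjective i
    obtain ⟨q, rfl⟩ := (eA S M (s+1) h1' h2).surjective j
    have e : ∀ n, n / (2^(s+1) * M) = n / (2^(s+1-1) * M) / 2 := by
      intro n; rw [Nat.div_div_eq_div_mul]; congr 1; simp; ring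
    rw [e, e, hdiv, hdiv] at hij
    have hx : p.1.1.1 = q.1.1.1 := by ext; omega
    rw [hv _ h1' h2, hv _ h1' h2, Amat_sum, Amat_sum, hx]
    congr 1
    refine Finset.sum_congr rfl fun b _ => Finset.sum_congr rfl fun d _ => ?_
    refine ih (by omega) _ _ ?_
    have := hdiv (s+1) h1' h2
    simp only [Nat.add_sub_cancel] at this ⊢
    rw [this, this]

lemma V_final (S M : ℕ) (hS : 0 < S) (hM : 0 < M) (v : ℕ → Fin (2^S * M) → ℝ)
    (hv : ∀ s, 1 ≤ s → s ≤ S → ∀ i, v s i = ∑ j, Amat S M s i j * v (s - 1) j) (i) :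
    v S i = (1 / ((2^S * M : ℕ) : ℝ)) * ∑ j, v 0 j := by
  have hsum : ∀ s, s ≤ S → ∑ j, v s j = ∑ j, v 0 j := by
    intro s
    induction s with
    | zero => simp
    | succ s ih =>
      intro h
      rw [← ih (by omega)]
      simp only [hv (s+1) (by omega) h]
      exact Amat_col S M (s+1) hM (by omega) h _
  rw [← hsum S le_rfl]
  have hc : ∀ j, v S j = v S i := fun j => by
    apply V_block S M hM v hv S hS le_rfl
    rw [Nat.div_eq_of_lt j.2, Nat.div_eq_of_lt i.2]
  simp only [hc, Finset.sum_const, Finset.card_univ, Fintype.card_fin, nsmul_eq_mul]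
  have : ((2^S * M : ℕ) : ℝ) ≠ 0 := by positivity
  field_simp

lemma rpow_le_exp (r : ℝ) (hr : 1 ≤ r) (x : ℝ) (hx : 0 ≤ x) :
    x ^ r ≤ (1 + (⌈r⌉₊.factorial : ℝ)) * Real.exp x := by
  have h1 : x ^ r ≤ 1 + x ^ ⌈r⌉₊ := by
    rcases le_total x 1 with h | h
    · have := Real.rpow_le_one hx h (by linarith : 0 ≤ r)
      have : 0 ≤ x ^ ⌈r⌉₊ := by positivity
      linarith
    · have := Real.rpow_le_rpow_of_exponent_le h (Nat.le_ceil r)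
      rw [Real.rpow_natCast] at this
      linarith
  have h2 := Real.pow_div_factorial_le_exp x hx ⌈r⌉₊
  rw [div_le_iff₀ (by positivity)] at h2
  have h3 := Real.one_le_exp hx
  linarith

lemma moment_of_mgf {Ω : Type*} {m0 : MeasurableSpace Ω} {μ : Measure Ω} [IsProbabilityMeasure μ]
    (r : ℝ) (hr : 1 ≤ r) (E : Ω → ℝ) (hE : Measurable E) (C : ℝ) (hC : ∀ ω, |E ω| ≤ C)
    (σ : ℝ) (hσ : 0 ≤ σ) (hσ0 : σ = 0 → ∀ ω, E ω = 0)
    (hm : ∀ t : ℝ, ∫ ω, Real.exp (t * E ω) ∂μ ≤ Real.exp (t ^ 2 * σ ^ 2 / 2)) :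
    (∫ ω, |E ω| ^ r ∂μ) ^ (1 / r) ≤
      ((1 + (⌈r⌉₊.factorial : ℝ)) * (2 * Real.exp (1/2))) ^ (1 / r) * σ := by
  have hr0 : 0 < r := by linarith
  rcases eq_or_lt_of_le hσ with h | h
  · have h0 := hσ0 h.symm
    simp only [h0, abs_zero, Real.zero_rpow hr0.ne', integral_zero]
    rw [Real.zero_rpow (by positivity), ← h, mul_zero]
  set D := (1 + (⌈r⌉₊.factorial : ℝ))
  have hD : 0 < D := by positivity
  have hexp : ∀ t : ℝ, Integrable (fun ω => Real.exp (t * E ω)) μ := by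
    intro t
    refine integrable_bdd (Real.measurable_exp.comp (hE.const_mul t)) (Real.exp (|t| * C)) fun ω => ?_
    rw [Real.abs_exp, Real.exp_le_exp]
    refine (le_abs_self _).trans ?_
    rw [abs_mul]
    exact mul_le_mul_of_nonneg_left (hC ω) (abs_nonneg _)
  have hbd : ∀ ω, |E ω| ^ r ≤ σ ^ r * (D * (Real.exp (σ⁻¹ * E ω) + Real.exp (-σ⁻¹ * E ω))) := by
    intro ω
    have e : |E ω| = σ * (σ⁻¹ * |E ω|) := by field_simp
    rw [e, Real.mul_rpow hσ (by positivity)]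
    refine mul_le_mul_of_nonneg_left ?_ (by positivity)
    refine (rpow_le_exp r hr _ (by positivity)).trans ?_
    refine mul_le_mul_of_nonneg_left ?_ hD.le
    rcases abs_cases (E ω) with ⟨h1, _⟩ | ⟨h1, _⟩ <;> rw [h1]
    · linarith [Real.exp_pos (-σ⁻¹ * E ω)]
    · rw [mul_neg, ← neg_mul]; linarith [Real.exp_pos (σ⁻¹ * E ω)]
  have hint : ∫ ω, |E ω| ^ r ∂μ ≤ σ ^ r * (D * (2 * Real.exp (1/2))) := by
    calc ∫ ω, |E ω| ^ r ∂μ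
        ≤ ∫ ω, σ ^ r * (D * (Real.exp (σ⁻¹ * E ω) + Real.exp (-σ⁻¹ * E ω))) ∂μ := by
          refine integral_mono_of_nonneg (Filter.Eventually.of_forall fun ω => by positivity)
            ((((hexp _).add (hexp _)).const_mul _).const_mul _) (Filter.Eventually.of_forall hbd)
      _ = σ ^ r * (D * (∫ ω, Real.exp (σ⁻¹ * E ω) ∂μ + ∫ ω, Real.exp (-σ⁻¹ * E ω) ∂μ)) := by
          rw [integral_const_mul, integral_const_mul, integral_add (hexp _) (hexp _)]
      _ ≤ _ := by
          have h1 := hm σ⁻¹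
          have h2 := hm (-σ⁻¹)
          have e : σ⁻¹ ^ 2 * σ ^ 2 = 1 := by field_simp
          rw [neg_sq] at h2
          rw [e] at h1 h2
          refine mul_le_mul_of_nonneg_left ?_ (by positivity)
          refine mul_le_mul_of_nonneg_left ?_ hD.le
          linarith
  calc _ ≤ (σ ^ r * (D * (2 * Real.exp (1/2)))) ^ (1 / r) :=
        Real.rpow_le_rpow (integral_nonneg fun ω => by positivity) hint (by positivity)
    _ = _ := by
        rw [Real.mul_rpow (by positivity) (by positivity), ← Real.rpow_mul hσ,
          mul_one_div_cancel hr0.ne', Real.rpow_one, mul_comm]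

/-- `L^r` error bound for augmented resampling. For any `r ≥ 1`
there is a finite constant `B_r` depending only on `r` such that, whatever the
distribution of `ξ_0`, the output of augmented resampling satisfies
`E[|((1/N)Σg(ξ_0^i))((1/N)Σφ(ξ_S^i)) − (1/N)Σg(ξ_0^i)φ(ξ_0^i)|^r]^{1/r}
  ≤ B_r √(S/N) ‖g‖ osc(φ)`,
where `‖g‖` is any bound with `g ≤ Cg` and `osc(φ)` any bound with
`|φ(x)−φ(y)| ≤ Cφ`. The algorithm is encoded as in STATEMENT 15. -/
theorem stmt16 (r : ℝ) (hr : 1 ≤ r) :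
    ∃ B : ℝ, ∀ (S M : ℕ), 0 < S → 0 < M →
      ∀ (Ω : Type) (m0 : MeasurableSpace Ω) (μ : Measure Ω), IsProbabilityMeasure μ →
      ∀ (X : Type) (mX : MeasurableSpace X)
        (ξ : ℕ → Fin (2^S * M) → Ω → X), (∀ s i, Measurable (ξ s i)) →
      ∀ (g : X → ℝ), Measurable g → (∀ x, 0 < g x) →
      ∀ (V : ℕ → Fin (2^S * M) → Ω → ℝ),
      (∀ i ω, V 0 i ω = g (ξ 0 i ω)) →
      (∀ s, 1 ≤ s → s ≤ S → ∀ i ω,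
        V s i ω = ∑ j, Amat S M s i j * V (s - 1) j ω) →
      ∀ (𝒢 : ℕ → MeasurableSpace Ω),
      (∀ s, 𝒢 s = ⨆ t ∈ Finset.range (s + 1),
        MeasurableSpace.comap (fun ω (i : Fin (2^S * M)) => ξ t i ω)
          MeasurableSpace.pi) →
      (∀ s, 1 ≤ s → s ≤ S → ∀ i, ∀ ψ : X → ℝ, Measurable ψ →
        (∃ C, ∀ x, |ψ x| ≤ C) →
        μ[(fun ω => ψ (ξ s i ω)) | 𝒢 (s - 1)] =ᵐ[μ]
          fun ω => (V s i ω)⁻¹ *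
            ∑ j, Amat S M s i j * V (s - 1) j ω * ψ (ξ (s - 1) j ω)) →
      (∀ s, 1 ≤ s → s ≤ S → ∀ ψ : Fin (2^S * M) → X → ℝ,
        (∀ i, Measurable (ψ i)) → (∀ i, ∃ C, ∀ x, |ψ i x| ≤ C) →
        μ[(fun ω => ∏ i, ψ i (ξ s i ω)) | 𝒢 (s - 1)] =ᵐ[μ]
          fun ω => ∏ i, (μ[(fun ω' => ψ i (ξ s i ω')) | 𝒢 (s - 1)]) ω) →
      ∀ (φ : X → ℝ), Measurable φ →
      ∀ (Cg Cφ : ℝ), (∀ x, g x ≤ Cg) → (∀ x y, |φ x - φ y| ≤ Cφ) →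
      (∫ ω, |((1 / ((2^S * M : ℕ) : ℝ)) * ∑ i, g (ξ 0 i ω)) *
            ((1 / ((2^S * M : ℕ) : ℝ)) * ∑ i, φ (ξ S i ω))
          - (1 / ((2^S * M : ℕ) : ℝ)) * ∑ i, g (ξ 0 i ω) * φ (ξ 0 i ω)| ^ r ∂μ)
          ^ (1 / r)
        ≤ B * Real.sqrt ((S : ℝ) / ((2^S * M : ℕ) : ℝ)) * Cg * Cφ := by 
  refine ⟨((1 + (⌈r⌉₊.factorial : ℝ)) * (2 * Real.exp (1/2))) ^ (1 / r), ?_⟩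
  intro S M hS hM Ω m0 μ hμ X mX ξ hξ g hg hgpos V hV0 hVs 𝒢 h𝒢 H1 H2 φ hφ Cg Cφ hCg hCφ
  have hN : 0 < 2^S * M := by positivity
  have hNr : (0:ℝ) < ((2^S * M : ℕ) : ℝ) := by exact_mod_cast hN
  obtain ⟨ω0⟩ : Nonempty Ω := μ.nonempty_of_neZero
  let x0 : X := ξ 0 ⟨0, hN⟩ ω0
  have hCg0 : 0 < Cg := (hgpos x0).trans_le (hCg x0)
  have hCφ0 : 0 ≤ Cφ := (abs_nonneg _).trans (hCφ x0 x0)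
  have hφb : ∀ x, |φ x| ≤ |φ x0| + Cφ := fun x => by
    have := abs_sub_abs_le_abs_sub (φ x) (φ x0)
    linarith [hCφ x x0]
  -- sigma-algebras
  have h𝒢le : ∀ s, 𝒢 s ≤ m0 := by
    intro s
    rw [h𝒢]
    refine iSup₂_le fun t _ => ?_
    exact (measurable_pi_lambda _ fun i => hξ t i).comap_le
  have h𝒢mono : ∀ s t, s ≤ t → 𝒢 s ≤ 𝒢 t := by
    intro s t hst
    rw [h𝒢, h𝒢]
    refine iSup₂_le fun u hu => ?_
    refine le_iSup₂_of_le u ?_ le_rfl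
    rw [Finset.mem_range] at hu ⊢
    omega
  have hξ𝒢 : ∀ s i, Measurable[𝒢 s] (ξ s i) := by
    intro s i
    have h1 : MeasurableSpace.comap (fun ω (i : Fin (2^S * M)) => ξ s i ω)
          MeasurableSpace.pi ≤ 𝒢 s := by
      rw [h𝒢]
      exact le_iSup₂_of_le s (by simp) le_rfl
    have h2 : Measurable[MeasurableSpace.comap (fun ω (i : Fin (2^S * M)) => ξ s i ω)
          MeasurableSpace.pi] (fun ω (i : Fin (2^S * M)) => ξ s i ω) :=
      comap_measurable _
    have h3 := (measurable_pi_apply i).comp h2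
    exact h3.mono h1 le_rfl
  -- the weights
  have hVm : ∀ s, s ≤ S → ∀ i, Measurable[𝒢 0] (V s i) := by
    intro s
    induction s with
    | zero =>
      intro _ i
      have : V 0 i = fun ω => g (ξ 0 i ω) := funext (hV0 i)
      rw [this]
      exact hg.comp (hξ𝒢 0 i)
    | succ s ih =>
      intro hs i
      have : V (s+1) i = fun ω => ∑ j, Amat S M (s+1) i j * V s j ω :=
        funext (hVs (s+1) (by omega) hs i)
      rw [this]
      exact Finset.measurable_sum _ fun j _ => (ih (by omega) j).const_mul _
  have hVb : ∀ s, s ≤ S → ∀ i ω, 0 < V s i ω ∧ V s i ω ≤ Cg := by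
    intro s
    induction s with
    | zero =>
      intro _ i ω
      rw [hV0]
      exact ⟨hgpos _, hCg _⟩
    | succ s ih =>
      intro hs i ω
      have hb := ih (by omega)
      have hrow := Amat_row S M (s+1) hM (by omega) hs i
      have hnn := Amat_nonneg S M (s+1) (by omega) hs i
      rw [hVs (s+1) (by omega) hs]
      simp only [Nat.add_sub_cancel]
      constructor
      · refine lt_of_le_of_ne (Finset.sum_nonneg fun j _ => mul_nonneg (hnn j) (hb j ω).1.le) ?_
        intro h0
        have h0' := (Finset.sum_eq_zero_iff_of_nonneg
          (fun j _ => mul_nonneg (hnn j) (hb j ω).1.le)).1 h0.symm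
        have : ∑ j, Amat S M (s+1) i j = 0 := Finset.sum_eq_zero fun j hj => by
          rcases mul_eq_zero.1 (h0' j hj) with h | h
          · exact h
          · exact absurd h (hb j ω).1.ne'
        linarith
      · calc _ ≤ ∑ j, Amat S M (s+1) i j * Cg :=
              Finset.sum_le_sum fun j _ => mul_le_mul_of_nonneg_left (hb j ω).2 (hnn j)
          _ = Cg := by rw [← Finset.sum_mul, hrow, one_mul]
  let Q : ℕ → Fin (2^S * M) → Ω → ℝ := fun u i ω =>
    ∑ j, Amat S M (u+1) i j * V u j ω * φ (ξ u j ω)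
  let Y : ℕ → Fin (2^S * M) → Ω → ℝ := fun u i ω =>
    V (u+1) i ω * φ (ξ (u+1) i ω) - Q u i ω
  have hQm : ∀ u, u < S → ∀ i, Measurable[𝒢 u] (Q u i) := by
    intro u hu i
    refine Finset.measurable_sum _ fun j _ => ?_
    exact (((hVm u hu.le j).mono (h𝒢mono 0 u (Nat.zero_le _)) le_rfl).const_mul _).mul
      (hφ.comp (hξ𝒢 u j))
  have hYm : ∀ u, u < S → ∀ i, Measurable[𝒢 (u+1)] (Y u i) := by
    intro u hu i
    exact (((hVm (u+1) hu i).mono (h𝒢mono 0 _ (Nat.zero_le _)) le_rfl).mul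
      (hφ.comp (hξ𝒢 _ i))).sub ((hQm u hu i).mono (h𝒢mono u _ (by omega)) le_rfl)
  have hVsum : ∀ u, u < S → ∀ i ω, V (u+1) i ω = ∑ j, Amat S M (u+1) i j * V u j ω :=
    fun u hu i ω => hVs (u+1) (by omega) hu i ω
  have hAV : ∀ u, u < S → ∀ i j ω, 0 ≤ Amat S M (u+1) i j * V u j ω := fun u hu i j ω =>
    mul_nonneg (Amat_nonneg S M (u+1) (by omega) hu i j) (hVb u hu.le j ω).1.le
  have hYb : ∀ u, u < S → ∀ i ω, |Y u i ω| ≤ Cg * Cφ := by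
    intro u hu i ω
    have e : Y u i ω = ∑ j, Amat S M (u+1) i j * V u j ω * (φ (ξ (u+1) i ω) - φ (ξ u j ω)) := by
      simp only [Y, Q, hVsum u hu i ω, mul_sub, Finset.sum_sub_distrib, Finset.sum_mul]
    rw [e]
    calc _ ≤ ∑ j, |Amat S M (u+1) i j * V u j ω * (φ (ξ (u+1) i ω) - φ (ξ u j ω))| :=
          Finset.abs_sum_le_sum_abs _ _
      _ ≤ ∑ j, Amat S M (u+1) i j * V u j ω * Cφ := by
          refine Finset.sum_le_sum fun j _ => ?_
          rw [abs_mul, abs_of_nonneg (hAV u hu i j ω)]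
          exact mul_le_mul_of_nonneg_left (hCφ _ _) (hAV u hu i j ω)
      _ = V (u+1) i ω * Cφ := by rw [← Finset.sum_mul, ← hVsum u hu i ω]
      _ ≤ _ := mul_le_mul_of_nonneg_right (hVb (u+1) hu i ω).2 hCφ0
  have hmb : ∀ u, u < S → ∀ i ω, |(V (u+1) i ω)⁻¹ * Q u i ω| ≤ |φ x0| + Cφ := by
    intro u hu i ω
    have hp := (hVb (u+1) hu i ω).1
    rw [abs_mul, abs_of_pos (inv_pos.2 hp), inv_mul_le_iff₀ hp]
    calc _ ≤ ∑ j, |Amat S M (u+1) i j * V u j ω * φ (ξ u j ω)| :=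
          Finset.abs_sum_le_sum_abs _ _
      _ ≤ ∑ j, Amat S M (u+1) i j * V u j ω * (|φ x0| + Cφ) := by
          refine Finset.sum_le_sum fun j _ => ?_
          rw [abs_mul, abs_of_nonneg (hAV u hu i j ω)]
          exact mul_le_mul_of_nonneg_left (hφb _) (hAV u hu i j ω)
      _ = _ := by rw [← Finset.sum_mul, ← hVsum u hu i ω]
  have hK0 : 0 ≤ Cg * Cφ := mul_nonneg hCg0.le hCφ0
  -- total sum
  let D : ℕ → Ω → ℝ := fun s ω => ∑ u ∈ Finset.range s, ∑ i, Y u i ω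
  have hDm : ∀ s, s ≤ S → Measurable[𝒢 s] (D s) := by
    intro s hs
    refine Finset.measurable_sum _ fun u hu => Finset.measurable_sum _ fun i _ => ?_
    rw [Finset.mem_range] at hu
    exact (hYm u (by omega) i).mono (h𝒢mono _ _ (by omega)) le_rfl
  have hDb : ∀ s, s ≤ S → ∀ ω, |D s ω| ≤ s * (((2^S * M : ℕ) : ℝ) * (Cg * Cφ)) := by
    intro s hs ω
    refine (Finset.abs_sum_le_sum_abs _ _).trans ?_
    refine (Finset.sum_le_card_nsmul _ _ (((2^S * M : ℕ) : ℝ) * (Cg * Cφ)) fun u hu => ?_).trans ?_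
    · rw [Finset.mem_range] at hu
      refine (Finset.abs_sum_le_sum_abs _ _).trans ?_
      refine (Finset.sum_le_card_nsmul _ _ (Cg * Cφ) fun i _ => hYb u (by omega) i ω).trans ?_
      simp
    · simp
  have hmgf : ∀ t : ℝ, ∀ s, s ≤ S → ∫ ω, Real.exp (t * D s ω) ∂μ ≤
      Real.exp (s * (((2^S * M : ℕ) : ℝ) * ((t * (Cg * Cφ)) ^ 2 / 2))) := by
    intro t s
    induction s with
    | zero => intro _; simp [D]
    | succ s ih =>
      intro hs
      have hs' : s < S := hs
      have hstep := step_mgf (h𝒢le s) (ξ (s+1)) (hξ (s+1))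
        (fun ψ h1 h2 => H2 (s+1) (by omega) hs ψ h1 h2) φ hφ ⟨_, hφb⟩ (V (s+1)) (Q s)
        (fun i => (hVm (s+1) hs i).mono (h𝒢mono 0 s (Nat.zero_le _)) le_rfl) (hQm s hs')
        (fun i ω => (hVb (s+1) hs i ω).1) Cg (fun i ω => (hVb (s+1) hs i ω).2)
        _ (hmb s hs') (fun i => H1 (s+1) (by omega) hs i φ hφ ⟨_, hφb⟩)
        (Cg * Cφ) (hYb s hs') t (fun ω => Real.exp (t * D s ω))
        (Real.measurable_exp.comp ((hDm s hs'.le).const_mul t)) (fun ω => (Real.exp_pos _).le)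
        (Real.exp (|t| * (s * (((2^S * M : ℕ) : ℝ) * (Cg * Cφ))))) (fun ω => by
          rw [Real.exp_le_exp]
          refine (le_abs_self _).trans ?_
          rw [abs_mul]
          exact mul_le_mul_of_nonneg_left (hDb s hs'.le ω) (abs_nonneg _)) Finset.univ
      have e : ∀ ω, Real.exp (t * D (s+1) ω) = Real.exp (t * D s ω) *
          Real.exp (t * ∑ i, (V (s+1) i ω * φ (ξ (s+1) i ω) - Q s i ω)) := by
        intro ω
        rw [← Real.exp_add, ← mul_add]
        simp only [D, Finset.sum_range_succ, Y]
      simp only [e]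
      refine hstep.trans ?_
      refine (mul_le_mul_of_nonneg_left (ih hs'.le) (Real.exp_pos _).le).trans (le_of_eq ?_)
      rw [← Real.exp_add]
      congr 1
      simp only [Finset.card_univ, Fintype.card_fin]
      push_cast
      ring
  -- telescoping
  have htel : ∀ s, s ≤ S → ∀ ω, D s ω =
      ∑ i, V s i ω * φ (ξ s i ω) - ∑ i, V 0 i ω * φ (ξ 0 i ω) := by
    intro s
    induction s with
    | zero => intro _ ω; simp [D]
    | succ s ih =>
      intro hs ω
      have e : D (s+1) ω = D s ω + ∑ i, Y s i ω := by simp only [D, Finset.sum_range_succ]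
      have e2 : ∑ i, Q s i ω = ∑ j, V s j ω * φ (ξ s j ω) := by
        simp only [Q, mul_assoc]
        exact Amat_col S M (s+1) hM (by omega) hs (fun j => V s j ω * φ (ξ s j ω))
      rw [e, ih (by omega)]
      simp only [Y, Finset.sum_sub_distrib, e2]
      ring
  have herr : ∀ ω, ((1 / ((2^S * M : ℕ) : ℝ)) * ∑ i, g (ξ 0 i ω)) *
            ((1 / ((2^S * M : ℕ) : ℝ)) * ∑ i, φ (ξ S i ω))
          - (1 / ((2^S * M : ℕ) : ℝ)) * ∑ i, g (ξ 0 i ω) * φ (ξ 0 i ω)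
      = (1 / ((2^S * M : ℕ) : ℝ)) * D S ω := by
    intro ω
    have hf := V_final S M hS hM (fun s i => V s i ω) (fun s h1 h2 i => hVs s h1 h2 i ω)
    rw [htel S le_rfl ω]
    simp only [hf, hV0, ← Finset.mul_sum]
    ring
  simp only [herr]
  set N : ℝ := ((2^S * M : ℕ) : ℝ) with hNdef
  have hSr : (0:ℝ) < S := by exact_mod_cast hS
  have hsq : Real.sqrt ((S:ℝ) / N) ^ 2 = (S:ℝ) / N := Real.sq_sqrt (by positivity)
  have hsqpos : 0 < Real.sqrt ((S:ℝ) / N) := Real.sqrt_pos.2 (by positivity)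
  have hfin := moment_of_mgf (μ := μ) r hr (fun ω => (1 / N) * D S ω)
    (((hDm S le_rfl).mono (h𝒢le S) le_rfl).const_mul _) ((1 / N) * (S * (N * (Cg * Cφ))))
    (fun ω => by
      rw [abs_mul, abs_of_pos (by positivity : 0 < 1 / N)]
      exact mul_le_mul_of_nonneg_left (hDb S le_rfl ω) (by positivity))
    (Real.sqrt ((S:ℝ) / N) * (Cg * Cφ)) (by positivity)
    (fun h0 ω => by
      have hz : Cg * Cφ = 0 := by
        rcases mul_eq_zero.1 h0 with h | h
        · exact absurd h hsqpos.ne'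
        · exact h
      have := hDb S le_rfl ω
      rw [hz] at this
      simp only [mul_zero, abs_nonpos_iff] at this
      simp [this])
    (fun t => by
      have h := hmgf (t * (1 / N)) S le_rfl
      simp only [← mul_assoc] at h ⊢
      refine h.trans (le_of_eq ?_)
      congr 1
      simp only [mul_pow, hsq]
      field_simp)
  refine hfin.trans (le_of_eq ?_)
  ring
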